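/- arXiv:0801.4133 — 4 statements merged into one kernel-verified Lean document; each statement's English description precedes it below -/
import Mathlib

section
/- For every model M of 𝔏: M is causally explained by Θ if and only if, as a world of K_Θ, M ⊨_□ (□p → p) ∧ (p → □p) for every sentence p of 𝔏_□. -/
/-!  Formalization of McCain–Turner causal theories (G. White,
"Simple Scheme, Deep Metatheory", arXiv:0801.4133). -/

/-- Formulas of the propositional language `𝔏`, generated from atoms in `α`
by `⊥, ⊤, ¬, ∧, ∨, →`. -/
inductive Fml (α : Type) : Type
  | atom : α → Fml α
  | fls  : Fml α
  | tru  : Fml α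
  | neg  : Fml α → Fml α
  | conj : Fml α → Fml α → Fml α
  | disj : Fml α → Fml α → Fml α
  | impl : Fml α → Fml α → Fml α
  deriving DecidableEq

variable {α : Type}

/-- A model of `𝔏`: a Boolean valuation of the atoms. -/
abbrev Model (α : Type) := α → Prop

/-- Truth of a formula in a model (`M ⊩ p`), extended truth-functionally. -/
def Fml.Sat (M : Model α) : Fml α → Prop
  | atom a => M a
  | fls => False
  | tru => True
  | neg p => ¬ Fml.Sat M p
  | conj p q => Fml.Sat M p ∧ Fml.Sat M q
  | disj p q => Fml.Sat M p ∨ Fml.Sat M q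
  | impl p q => Fml.Sat M p → Fml.Sat M q

/-- `Γ ⊢ p` : every model of `Γ` satisfies `p`. -/
def Entails (Γ : Set (Fml α)) (p : Fml α) : Prop :=
  ∀ M : Model α, (∀ q ∈ Γ, Fml.Sat M q) → Fml.Sat M p

/-- A causal theory `Θ`: a set of causal rules `φ ▷ ψ`, i.e. ordered pairs of
sentences of `𝔏`. -/
abbrev CausalTheory (α : Type) := Set (Fml α × Fml α)

/-- `M R_Θ M'` iff for every `φ ▷ ψ ∈ Θ`, if `M ⊩ φ` then `M' ⊩ ψ`. -/
def RTheta (Θ : CausalTheory α) (M M' : Model α) : Prop :=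
  ∀ r ∈ Θ, Fml.Sat M r.1 → Fml.Sat M' r.2

/-- `M^Θ` : the set of sentences entailed by `{ψ | φ ▷ ψ ∈ Θ and M ⊩ φ}`. -/
def MTheta (Θ : CausalTheory α) (M : Model α) : Set (Fml α) :=
  {p | Entails {ψ | ∃ φ, (φ, ψ) ∈ Θ ∧ Fml.Sat M φ} p}

/-- `M` is causally explained by `Θ` iff `M` is the unique model satisfying
every sentence of `M^Θ`. -/
def CausallyExplained (Θ : CausalTheory α) (M : Model α) : Prop :=
  {M' : Model α | ∀ p ∈ MTheta Θ M, Fml.Sat M' p} = {M}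

/-- Formulas of the modal language `𝔏_□`: `𝔏` extended by a unary operator `□`. -/
inductive MFml (α : Type) : Type
  | atom : α → MFml α
  | fls  : MFml α
  | tru  : MFml α
  | neg  : MFml α → MFml α
  | conj : MFml α → MFml α → MFml α
  | disj : MFml α → MFml α → MFml α
  | impl : MFml α → MFml α → MFml α
  | box  : MFml α → MFml α
  deriving DecidableEq

/-- The inclusion of `𝔏` into `𝔏_□`. -/
def Fml.toM : Fml α → MFml α
  | atom a => .atom a
  | fls => .fls
  | tru => .tru
  | neg p => .neg p.toM
  | conj p q => .conj p.toM q.toM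
  | disj p q => .disj p.toM q.toM
  | impl p q => .impl p.toM q.toM

/-- Forcing `M ⊨_□ p` at a world `M` of the Kripke model `K_Θ` (whose worlds
are the models of `𝔏` and whose accessibility relation is `R_Θ`):
atoms by `⊩`, Boolean connectives truth-functionally, and
`M ⊨_□ □p` iff `M' ⊨_□ p` for every `M'` with `M R_Θ M'`. -/
def MSat (Θ : CausalTheory α) : Model α → MFml α → Prop
  | M, .atom a => M a
  | _, .fls => False
  | _, .tru => True
  | M, .neg p => ¬ MSat Θ M p
  | M, .conj p q => MSat Θ M p ∧ MSat Θ M q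
  | M, .disj p q => MSat Θ M p ∨ MSat Θ M q
  | M, .impl p q => MSat Θ M p → MSat Θ M q
  | M, .box p => ∀ M' : Model α, RTheta Θ M M' → MSat Θ M' p

/-- The semantic value `⟦p⟧ = {M | M ⊨_□ p}` in `K_Θ`. -/
def SemVal (Θ : CausalTheory α) (p : MFml α) : Set (Model α) := {M | MSat Θ M p}

/-- `Γ ⊨_□ Δ` : `⋂_{p∈Γ} ⟦p⟧ ⊆ ⋃_{q∈Δ} ⟦q⟧` in the Kripke model `K_Θ`. -/
def MSemEntails (Θ : CausalTheory α) (Γ Δ : Set (MFml α)) : Prop :=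
  (⋂ p ∈ Γ, SemVal Θ p) ⊆ ⋃ q ∈ Δ, SemVal Θ q

/-- The models of `M^Θ` are exactly the `R_Θ`-successors of `M`. -/
theorem setOf_sat_MTheta (Θ : CausalTheory α) (M : Model α) :
    {M' : Model α | ∀ p ∈ MTheta Θ M, Fml.Sat M' p} = {M' | RTheta Θ M M'} := by
  ext M'
  constructor
  · intro h r hr hM
    exact h r.2 fun N hN => hN r.2 ⟨r.1, hr, hM⟩
  · intro h p hp
    refine hp M' ?_
    rintro ψ ⟨φ, hr, hM⟩
    exact h (φ, ψ) hr hM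

/-- For every model `M` of `𝔏`: `M` is causally explained by `Θ`
iff, as a world of `K_Θ`, `M ⊨_□ (□p → p) ∧ (p → □p)` for every sentence `p`
of `𝔏_□`. -/
theorem causallyExplained_iff_modal (Θ : CausalTheory α) (M : Model α) :
    CausallyExplained Θ M ↔
      ∀ p : MFml α,
        MSat Θ M (MFml.conj (MFml.impl (MFml.box p) p)
                            (MFml.impl p (MFml.box p))) := by
  rw [CausallyExplained, setOf_sat_MTheta]
  constructor
  · intro h p
    have hR : ∀ M', RTheta Θ M M' ↔ M' = M := fun M' => Set.ext_iff.mp h M'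
    exact ⟨fun hb => hb M ((hR M).mpr rfl), fun hp M' hM' => (hR M').mp hM' ▸ hp⟩
  · intro h
    have hsub : ∀ M', RTheta Θ M M' → M' = M := by
      intro M' hM'
      funext a
      refine propext ⟨fun ha => ?_, fun ha => (h (.atom a)).2 ha M' hM'⟩
      by_contra hna
      exact (h (.neg (.atom a))).2 hna M' hM' ha
    obtain ⟨N, hN⟩ : ∃ N, RTheta Θ M N := by
      by_contra hne
      exact (h .fls).1 fun N hN => hne ⟨N, hN⟩
    exact Set.eq_singleton_iff_unique_mem.mpr ⟨hsub N hN ▸ hN, hsub⟩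
end

section
/- Let K be any Kripke model of 𝔏_□ such that for every φ ▷ ψ ∈ Θ and every world w of K, w ⊨ φ → □ψ. For every world w of K and every non-modal sentence p ∈ 𝔏: if η(w) ⊨_□ □p in K_Θ, then w ⊨ □p in K. -/
variable {α : Type}

/-- A Kripke model of `𝔏_□`: a set of worlds, an accessibility relation and
a valuation of atoms at worlds. -/
structure Kripke (α : Type) where
  World : Type
  rel : World → World → Prop
  val : World → α → Prop

/-- Forcing `w ⊨ p` in a Kripke model: truth-functional at each world, and
`w ⊨ □p` iff `w' ⊨ p` for all `w'` with `w R_K w'`. -/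
def Kripke.Force (K : Kripke α) : K.World → MFml α → Prop
  | w, .atom a => K.val w a
  | _, .fls => False
  | _, .tru => True
  | w, .neg p => ¬ Kripke.Force K w p
  | w, .conj p q => Kripke.Force K w p ∧ Kripke.Force K w q
  | w, .disj p q => Kripke.Force K w p ∨ Kripke.Force K w q
  | w, .impl p q => Kripke.Force K w p → Kripke.Force K w q
  | w, .box p => ∀ w', K.rel w w' → Kripke.Force K w' p

/-- `η(w)`: the model of `𝔏` determined by `{p ∈ 𝔏 | w ⊨ p}`, i.e. the model
whose true atoms are exactly the atoms forced at `w`. -/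
def Kripke.eta (K : Kripke α) (w : K.World) : Model α := fun a => K.val w a

/-- In `K_Θ`, non-modal sentences are evaluated truth-functionally. -/
theorem MSat_toM (Θ : CausalTheory α) (M : Model α) (p : Fml α) :
    MSat Θ M p.toM ↔ Fml.Sat M p := by
  induction p <;> simp_all [Fml.toM, MSat, Fml.Sat]

/-- A world `w` forces a non-modal sentence iff the model `η(w)` satisfies it. -/
theorem Kripke.force_toM (K : Kripke α) (w : K.World) (p : Fml α) :
    K.Force w p.toM ↔ Fml.Sat (K.eta w) p := by
  induction p <;> simp_all [Fml.toM, Kripke.Force, Fml.Sat, Kripke.eta]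

/-- If `K` validates `φ → □ψ` for every `φ ▷ ψ ∈ Θ`, then `η` maps the accessibility
relation of `K` into `R_Θ`. -/
theorem Kripke.rTheta_eta {Θ : CausalTheory α} {K : Kripke α}
    (hK : ∀ r ∈ Θ, ∀ w : K.World,
      K.Force w (MFml.impl (Fml.toM r.1) (MFml.box (Fml.toM r.2))))
    {w w' : K.World} (hw : K.rel w w') : RTheta Θ (K.eta w) (K.eta w') :=
  fun r hr hφ => (K.force_toM w' r.2).1 (hK r hr w ((K.force_toM w r.1).2 hφ) w' hw)

/-- Let `K` be any Kripke model of `𝔏_□` such that for every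
`φ ▷ ψ ∈ Θ` and every world `w` of `K`, `w ⊨ φ → □ψ`.  For every world `w`
of `K` and every non-modal sentence `p ∈ 𝔏`: if `η(w) ⊨_□ □p` in `K_Θ`, then
`w ⊨ □p` in `K`. -/
theorem box_strongest_in_canonical (Θ : CausalTheory α) (K : Kripke α)
    (hK : ∀ r ∈ Θ, ∀ w : K.World,
      K.Force w (MFml.impl (Fml.toM r.1) (MFml.box (Fml.toM r.2))))
    (w : K.World) (p : Fml α)
    (h : MSat Θ (K.eta w) (MFml.box p.toM)) :
    K.Force w (MFml.box p.toM) := by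
  intro w' hw
  exact (K.force_toM w' p).2 ((MSat_toM Θ _ p).1 (h _ (Kripke.rTheta_eta hK hw)))
end

section
/- Soundness of the modal translation of the Parsons–Jennings system: if Θ ⊢_ACR (p, Γ) is derivable in the Parsons–Jennings argumentation system, then the sequent Γ ⊢_□ □_Θ p is derivable in the modal sequent calculus for the causal theory {(⋀Γ') ▷ q | (q, Γ') ∈ Θ}. -/
variable {α : Type}

/-- The conjunction `φ₁ ∧ … ∧ φ_k` of a list of formulas of `𝔏_□`. -/
def conjList : List (MFml α) → MFml α
  | [] => .tru
  | [p] => p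
  | p :: q :: ps => .conj p (conjList (q :: ps))

/-- The side condition `ψ₁, …, ψ_k ⊢_□ p` of the `□`-rules (the `ψᵢ` being
non-modal sentences of `𝔏`, `p ∈ 𝔏_□`).  It occurs *negatively* in the rule
`□L`, so it cannot literally be derivability in a strictly positive inductive
definition of the calculus; we formalise it as semantic entailment in `K_Θ`,
which by the paper's restricted soundness and completeness theorem
(its Lemma 4.11) coincides with `⊢_□` for sequents of exactly this shape. -/
def SideCond (Θ : CausalTheory α) (ψs : List (Fml α)) (p : MFml α) : Prop :=
  ∀ M : Model α, (∀ ψ ∈ ψs, Fml.Sat M ψ) → MSat Θ M p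

/-- The modal sequent calculus `Γ ⊢_□ Δ` determined by the causal theory `Θ`.
Sequents are pairs of *sets* of formulas of `𝔏_□` (as in the paper); with
sets, the contraction rules are as below and multicut takes the form of the
`cut` rule (the multiplicities `pᵐ, pⁿ` collapse).  The rule `□R` carries its
side condition `ψ₁, …, ψ_k ⊢_□ p` as a (positively occurring) derivability
premise; the rule `□L` has one premise for each finite set of causal rules
`φ₁ ▷ ψ₁, …, φ_k ▷ ψ_k ∈ Θ` satisfying the side condition `SideCond`. -/
inductive Der (Θ : CausalTheory α) : Set (MFml α) → Set (MFml α) → Prop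
  | ax (p : MFml α) : Der Θ {p} {p}
  | falL : Der Θ {MFml.fls} (∅ : Set (MFml α))
  | truR : Der Θ (∅ : Set (MFml α)) {MFml.tru}
  | wL {Γ Δ : Set (MFml α)} (p : MFml α) :
      Der Θ Γ Δ → Der Θ (insert p Γ) Δ
  | wR {Γ Δ : Set (MFml α)} (p : MFml α) :
      Der Θ Γ Δ → Der Θ Γ (insert p Δ)
  | cL {Γ Δ : Set (MFml α)} {p : MFml α} :
      Der Θ (insert p (insert p Γ)) Δ → Der Θ (insert p Γ) Δ
  | cR {Γ Δ : Set (MFml α)} {p : MFml α} :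
      Der Θ Γ (insert p (insert p Δ)) → Der Θ Γ (insert p Δ)
  | negL {Γ Δ : Set (MFml α)} {p : MFml α} :
      Der Θ Γ (insert p Δ) → Der Θ (insert (MFml.neg p) Γ) Δ
  | negR {Γ Δ : Set (MFml α)} {p : MFml α} :
      Der Θ (insert p Γ) Δ → Der Θ Γ (insert (MFml.neg p) Δ)
  | conjL {Γ Δ : Set (MFml α)} {p q : MFml α} :
      Der Θ (insert p (insert q Γ)) Δ → Der Θ (insert (MFml.conj p q) Γ) Δ
  | conjR {Γ Δ : Set (MFml α)} {p q : MFml α} :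
      Der Θ Γ (insert p Δ) → Der Θ Γ (insert q Δ) →
      Der Θ Γ (insert (MFml.conj p q) Δ)
  | disjL {Γ Δ : Set (MFml α)} {p q : MFml α} :
      Der Θ (insert p Γ) Δ → Der Θ (insert q Γ) Δ →
      Der Θ (insert (MFml.disj p q) Γ) Δ
  | disjR {Γ Δ : Set (MFml α)} {p q : MFml α} :
      Der Θ Γ (insert p (insert q Δ)) → Der Θ Γ (insert (MFml.disj p q) Δ)
  | implL {Γ Δ : Set (MFml α)} {p q : MFml α} :
      Der Θ Γ (insert p Δ) → Der Θ (insert q Γ) Δ →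
      Der Θ (insert (MFml.impl p q) Γ) Δ
  | implR {Γ Δ : Set (MFml α)} {p q : MFml α} :
      Der Θ (insert p Γ) (insert q Δ) → Der Θ Γ (insert (MFml.impl p q) Δ)
  | cut {Γ Γ' Δ Δ' : Set (MFml α)} {p : MFml α} :
      Der Θ Γ (insert p Δ) → Der Θ (insert p Γ') Δ' →
      Der Θ (Γ ∪ Γ') (Δ ∪ Δ')
  | boxR {Γ Δ : Set (MFml α)} {p : MFml α} (rs : List (Fml α × Fml α))
      (hrs : ∀ r ∈ rs, r ∈ Θ)
      (hprem : Der Θ Γ (insert (conjList (rs.map fun r => Fml.toM r.1)) Δ))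
      (hside : Der Θ {q | ∃ r ∈ rs, q = Fml.toM r.2} {p}) :
      Der Θ Γ (insert (MFml.box p) Δ)
  | boxL {Γ Δ : Set (MFml α)} {p : MFml α}
      (hprem : ∀ rs : List (Fml α × Fml α), (∀ r ∈ rs, r ∈ Θ) →
        SideCond Θ (rs.map Prod.snd) p →
        Der Θ (Γ ∪ {q | ∃ r ∈ rs, q = Fml.toM r.1}) Δ) :
      Der Θ (insert (MFml.box p) Γ) Δ

/-- A set of basic arguments: pairs `(p, Γ)` with `p ∈ 𝔏` and `Γ` a finite
set of sentences of `𝔏`. -/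
abbrev PJTheory (α : Type) := Set (Fml α × Finset (Fml α))

/-- The conjunction of a list of sentences of `𝔏`. -/
def conjFml : List (Fml α) → Fml α
  | [] => .tru
  | [p] => p
  | p :: q :: ps => .conj p (conjFml (q :: ps))

/-- The conjunction `⋀Γ` of a finite set of sentences of `𝔏`. -/
noncomputable def finConj (Γ : Finset (Fml α)) : Fml α := conjFml Γ.toList

/-- The causal theory `{(⋀Γ') ▷ q | (q, Γ') ∈ Θ}` determined by a set `Θ`
of basic arguments. -/
def pjTheory (Θ : PJTheory α) : CausalTheory α :=
  {r | ∃ q Γ', (q, Γ') ∈ Θ ∧ r = (finConj Γ', q)}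

/-- The Parsons–Jennings argumentation system: `ACR Θ p Γ` formalises
`Θ ⊢_ACR (p, Γ)`. -/
inductive ACR [DecidableEq α] : PJTheory α → Fml α → Finset (Fml α) → Prop
  | ax {Θ : PJTheory α} {p : Fml α} {Γ : Finset (Fml α)} :
      (p, Γ) ∈ Θ → ACR Θ p Γ
  | truI {Θ : PJTheory α} : ACR Θ Fml.tru ∅
  | conjI {Θ : PJTheory α} {p q : Fml α} {Γ Γ' : Finset (Fml α)} :
      ACR Θ p Γ → ACR Θ q Γ' → ACR Θ (Fml.conj p q) (Γ ∪ Γ')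
  | conjE1 {Θ : PJTheory α} {p q : Fml α} {Γ : Finset (Fml α)} :
      ACR Θ (Fml.conj p q) Γ → ACR Θ p Γ
  | conjE2 {Θ : PJTheory α} {p q : Fml α} {Γ : Finset (Fml α)} :
      ACR Θ (Fml.conj p q) Γ → ACR Θ q Γ
  | disjI1 {Θ : PJTheory α} {p q : Fml α} {Γ : Finset (Fml α)} :
      ACR Θ p Γ → ACR Θ (Fml.disj p q) Γ
  | disjI2 {Θ : PJTheory α} {p q : Fml α} {Γ : Finset (Fml α)} :
      ACR Θ q Γ → ACR Θ (Fml.disj p q) Γ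
  | disjE {Θ : PJTheory α} {p q r : Fml α} {Γ Γ' Γ'' : Finset (Fml α)} :
      ACR Θ (Fml.disj p q) Γ →
      ACR (insert (p, Γ) Θ) r Γ' → ACR (insert (q, Γ) Θ) r Γ'' →
      ACR Θ r (Γ' ∪ Γ'')
  | negI {Θ : PJTheory α} {p : Fml α} {Γ : Finset (Fml α)} :
      ACR (insert (p, (∅ : Finset (Fml α))) Θ) Fml.fls Γ → ACR Θ (Fml.neg p) Γ
  | negE {Θ : PJTheory α} {p : Fml α} {Γ : Finset (Fml α)} :
      ACR Θ p Γ → ACR Θ (Fml.neg p) Γ → ACR Θ Fml.fls Γ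
  | implI {Θ : PJTheory α} {p q : Fml α} {Γ : Finset (Fml α)} :
      ACR (insert (p, (∅ : Finset (Fml α))) Θ) q Γ → ACR Θ (Fml.impl p q) Γ
  | implE {Θ : PJTheory α} {p q : Fml α} {Γ Δ : Finset (Fml α)} :
      ACR Θ p Γ → ACR Θ (Fml.impl p q) Δ → ACR Θ q (Γ ∪ Δ)
  | efq {Θ : PJTheory α} {p : Fml α} {Γ : Finset (Fml α)} :
      ACR Θ Fml.fls Γ → ACR Θ p Γ
  | raa {Θ : PJTheory α} {p : Fml α} {Γ : Finset (Fml α)} :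
      ACR (insert (Fml.neg p, (∅ : Finset (Fml α))) Θ) Fml.fls Γ → ACR Θ p Γ

namespace Der

variable {T : CausalTheory α} {Γ Γ' Δ Δ' : Set (MFml α)} {p q r : MFml α}

theorem weakening_left (h : Der T Γ Δ) (hs : Γ ⊆ Γ') (hf : Γ'.Finite) : Der T Γ' Δ := by
  suffices H : ∀ S : Set (MFml α), S.Finite → Der T (S ∪ Γ) Δ by
    simpa [Set.union_eq_left.2 hs] using H Γ' hf
  intro S hS
  induction S, hS using Set.Finite.induction_on with
  | empty => simpa using h
  | insert _ _ ih => rw [Set.insert_union]; exact wL _ ih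

theorem weakening_right (h : Der T Γ Δ) (hs : Δ ⊆ Δ') (hf : Δ'.Finite) : Der T Γ Δ' := by
  suffices H : ∀ S : Set (MFml α), S.Finite → Der T Γ (S ∪ Δ) by
    simpa [Set.union_eq_left.2 hs] using H Δ' hf
  intro S hS
  induction S, hS using Set.Finite.induction_on with
  | empty => simpa using h
  | insert _ _ ih => rw [Set.insert_union]; exact wR _ ih

theorem of_mem (hΓ : Γ.Finite) (hΔ : Δ.Finite) (h₁ : p ∈ Γ) (h₂ : p ∈ Δ) : Der T Γ Δ :=
  ((ax p).weakening_left (by simpa using h₁) hΓ).weakening_right (by simpa using h₂) hΔ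

theorem cut_singleton (h₁ : Der T Γ {p}) (h₂ : Der T (insert p Γ') Δ) : Der T (Γ ∪ Γ') Δ := by
  simpa using cut (Δ := ∅) (by simpa using h₁) h₂

theorem tru_right (hΓ : Γ.Finite) : Der T Γ {.tru} :=
  truR.weakening_left (Set.empty_subset _) hΓ

theorem conj_right (h₁ : Der T Γ {p}) (h₂ : Der T Γ {q}) : Der T Γ {.conj p q} := by
  simpa using conjR (Δ := ∅) (by simpa using h₁) (by simpa using h₂)

theorem impl_right (h : Der T (insert p Γ) {q}) : Der T Γ {.impl p q} := by
  simpa using implR (Δ := ∅) (by simpa using h)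

theorem conjList_right (hΓ : Γ.Finite) :
    ∀ l : List (MFml α), (∀ x ∈ l, Der T Γ {x}) → Der T Γ {conjList l}
  | [], _ => tru_right hΓ
  | [p], h => h p (List.mem_singleton_self p)
  | _ :: q :: l, h =>
    conj_right (h _ (by simp)) (conjList_right hΓ (q :: l) fun x hx => h x (by simp [hx]))

theorem conj_intro : Der T {p, q} {.conj p q} :=
  conj_right (of_mem (p := p) (by simp) (by simp) (by simp) (by simp))
    (of_mem (p := q) (by simp) (by simp) (by simp) (by simp))

theorem conj_elim_left : Der T {.conj p q} {p} := by
  rw [← insert_empty_eq]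
  exact conjL (of_mem (p := p) (by simp) (by simp) (by simp) (by simp))

theorem conj_elim_right : Der T {.conj p q} {q} := by
  rw [← insert_empty_eq]
  exact conjL (of_mem (p := q) (by simp) (by simp) (by simp) (by simp))

theorem disj_intro_left : Der T {p} {.disj p q} := by
  rw [← insert_empty_eq (MFml.disj p q)]
  exact disjR (of_mem (p := p) (by simp) (by simp) (by simp) (by simp))

theorem disj_intro_right : Der T {q} {.disj p q} := by
  rw [← insert_empty_eq (MFml.disj p q)]
  exact disjR (of_mem (p := q) (by simp) (by simp) (by simp) (by simp))

theorem disj_impl_left : Der T {.disj p q, .impl p r} {.disj q r} := by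
  rw [← insert_empty_eq (MFml.disj q r)]
  refine disjR (disjL ?_ (of_mem (p := q) (by simp) (by simp) (by simp) (by simp)))
  rw [Set.pair_comm]
  exact implL (of_mem (p := p) (by simp) (by simp) (by simp) (by simp))
    (of_mem (p := r) (by simp) (by simp) (by simp) (by simp))

theorem modus_ponens : Der T {p, .impl p q} {q} := by
  rw [Set.pair_comm]
  exact implL (of_mem (p := p) (by simp) (by simp) (by simp) (by simp))
    (of_mem (p := q) (by simp) (by simp) (by simp) (by simp))

theorem disj_elim_right : Der T {.disj q r, .impl q r} {r} :=
  disjL modus_ponens (of_mem (p := r) (by simp) (by simp) (by simp) (by simp))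

theorem neg_elim : Der T {p, .neg p} {.fls} := by
  rw [Set.pair_comm]
  exact negL (of_mem (p := p) (by simp) (by simp) (by simp) (by simp))

theorem ex_falso : Der T {.fls} {p} :=
  falL.weakening_right (Set.empty_subset _) (by simp)

theorem neg_of_impl_fls : Der T {.impl p .fls} {.neg p} := by
  rw [← insert_empty_eq (MFml.neg p)]
  refine negR ?_
  rw [Set.pair_comm]
  exact implL (of_mem (p := p) (by simp) (by simp) (by simp) (by simp))
    (falL.weakening_left (by simp) (by simp))

theorem of_neg_impl_fls : Der T {.impl (.neg p) .fls} {p} := by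
  rw [← insert_empty_eq (MFml.impl _ _)]
  refine implL (negR (of_mem (p := p) (by simp) (by simp) (by simp) (by simp))) ?_
  simpa using ex_falso

end Der

theorem toM_conjFml : ∀ l : List (Fml α), (conjFml l).toM = conjList (l.map Fml.toM)
  | [] => rfl
  | [_] => rfl
  | p :: q :: l => by
    simpa [conjFml, conjList, Fml.toM] using toM_conjFml (q :: l)

theorem Der.finConj_right {T : CausalTheory α} {Γ Γ' : Finset (Fml α)} (h : Γ' ⊆ Γ) :
    Der T (Fml.toM '' (Γ : Set (Fml α))) {(finConj Γ').toM} := by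
  have hf : (Fml.toM '' (Γ : Set (Fml α))).Finite := Γ.finite_toSet.image _
  rw [finConj, toM_conjFml]
  refine conjList_right hf _ fun x hx => ?_
  obtain ⟨y, hy, rfl⟩ := List.mem_map.1 hx
  exact of_mem hf (by simp) (Set.mem_image_of_mem _ (h (Finset.mem_toList.1 hy))) rfl

/-- `p` is derivable, in the calculus for `T`, from the conclusions of finitely many basic
arguments of `Θ` whose supports are contained in `Γ`. -/
def Supported (T : CausalTheory α) (Θ : PJTheory α) (Γ : Finset (Fml α)) (p : Fml α) : Prop :=
  ∃ F : PJTheory α, F.Finite ∧ F ⊆ Θ ∧ (∀ a ∈ F, a.2 ⊆ Γ) ∧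
    Der T ((fun a => a.1.toM) '' F) {p.toM}

namespace Supported

variable {T : CausalTheory α} {Θ : PJTheory α} {Γ Γ' Γ₀ : Finset (Fml α)} {p q r : Fml α}

theorem mono (h : Supported T Θ Γ p) (hs : Γ ⊆ Γ') : Supported T Θ Γ' p := by
  obtain ⟨F, hf, hΘ, hΓ, hd⟩ := h
  exact ⟨F, hf, hΘ, fun a ha => (hΓ a ha).trans hs, hd⟩

theorem map (h : Supported T Θ Γ p) (hd : Der T {p.toM} {q.toM}) : Supported T Θ Γ q := by
  obtain ⟨F, hf, hΘ, hΓ, hp⟩ := h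
  exact ⟨F, hf, hΘ, hΓ, by simpa using hp.cut_singleton (Γ' := ∅) (by simpa using hd)⟩

theorem map₂ (hp : Supported T Θ Γ p) (hq : Supported T Θ Γ q)
    (hd : Der T {p.toM, q.toM} {r.toM}) : Supported T Θ Γ r := by
  obtain ⟨F, hf, hΘ, hΓ, hp⟩ := hp
  obtain ⟨G, hg, hΘ', hΓ', hq⟩ := hq
  refine ⟨G ∪ F, hg.union hf, Set.union_subset hΘ' hΘ, ?_, ?_⟩
  · rintro a (ha | ha)
    exacts [hΓ' a ha, hΓ a ha]
  · have h := hp.cut_singleton hd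
    rw [Set.union_comm, Set.singleton_union] at h
    simpa [Set.image_union] using hq.cut_singleton h

theorem impl_of_insert (h : Supported T (insert (p, Γ₀) Θ) Γ r) :
    Supported T Θ Γ (.impl p r) := by
  obtain ⟨F, hf, hΘ, hΓ, hd⟩ := h
  refine ⟨F \ {(p, Γ₀)}, hf.sdiff, fun a ha => (hΘ ha.1).resolve_left ha.2,
    fun a ha => hΓ a ha.1, Der.impl_right (hd.weakening_left ?_ ?_)⟩
  · rintro _ ⟨a, ha, rfl⟩
    by_cases h : a = (p, Γ₀)
    · simp [h]
    · exact Or.inr ⟨a, ⟨ha, h⟩, rfl⟩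
  · exact (hf.sdiff.image _).insert _

theorem subset_or_of_insert (h : Supported T (insert (p, Γ₀) Θ) Γ r) :
    Γ₀ ⊆ Γ ∨ Supported T Θ Γ r := by
  obtain ⟨F, hf, hΘ, hΓ, hd⟩ := h
  by_cases h : (p, Γ₀) ∈ F
  · exact .inl (hΓ _ h)
  · exact .inr ⟨F, hf, fun a ha => (hΘ ha).resolve_left fun e => h (e ▸ ha), hΓ, hd⟩

theorem der_box (h : Supported (pjTheory Θ) Θ Γ p) :
    Der (pjTheory Θ) (Fml.toM '' (Γ : Set (Fml α))) {.box p.toM} := by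
  obtain ⟨F, hf, hΘ, hΓ, hd⟩ := h
  lift F to Finset (Fml α × Finset (Fml α)) using hf
  rw [← insert_empty_eq (MFml.box _)]
  refine Der.boxR (F.toList.map fun a => (finConj a.2, a.1)) ?_ ?_ ?_
  · simp only [List.mem_map, Finset.mem_toList]
    rintro _ ⟨a, ha, rfl⟩
    exact ⟨a.1, a.2, hΘ ha, rfl⟩
  · rw [insert_empty_eq]
    refine Der.conjList_right (Γ.finite_toSet.image _) _ fun x hx => ?_
    simp only [List.map_map, List.mem_map, Finset.mem_toList] at hx
    obtain ⟨a, ha, rfl⟩ := hx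
    exact Der.finConj_right (hΓ a ha)
  · convert hd using 1
    ext x
    simp [eq_comm]

end Supported

theorem ACR.supported [DecidableEq α] (T : CausalTheory α) {Θ : PJTheory α} {p : Fml α}
    {Γ : Finset (Fml α)} (h : ACR Θ p Γ) : Supported T Θ Γ p := by
  induction h with
  | ax h => exact ⟨{_}, by simp, by simpa using h, by simp, by simpa using Der.ax _⟩
  | truI => exact ⟨∅, by simp, by simp, by simp, Der.tru_right (by simp)⟩
  | conjI _ _ ih₁ ih₂ =>
    exact (ih₁.mono Finset.subset_union_left).map₂ (ih₂.mono Finset.subset_union_right)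
      Der.conj_intro
  | conjE1 _ ih => exact ih.map Der.conj_elim_left
  | conjE2 _ ih => exact ih.map Der.conj_elim_right
  | disjI1 _ ih => exact ih.map Der.disj_intro_left
  | disjI2 _ ih => exact ih.map Der.disj_intro_right
  | @disjE Θ p q r Γ Γ' Γ'' _ _ _ ih ih₁ ih₂ =>
    rcases ih₁.subset_or_of_insert with hs | h
    · have hpr := ih₁.impl_of_insert.mono (Finset.subset_union_left (s₂ := Γ''))
      have hqr := ih₂.impl_of_insert.mono (Finset.subset_union_right (s₁ := Γ'))
      have hqr' : Supported T Θ (Γ' ∪ Γ'') (.disj q r) :=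
        (ih.mono (hs.trans Finset.subset_union_left)).map₂ hpr Der.disj_impl_left
      exact hqr'.map₂ hqr Der.disj_elim_right
    · exact h.mono Finset.subset_union_left
  | negI _ ih => exact ih.impl_of_insert.map Der.neg_of_impl_fls
  | negE _ _ ih₁ ih₂ => exact ih₁.map₂ ih₂ Der.neg_elim
  | implI _ ih => exact ih.impl_of_insert
  | implE _ _ ih₁ ih₂ =>
    exact (ih₁.mono Finset.subset_union_left).map₂ (ih₂.mono Finset.subset_union_right)
      Der.modus_ponens
  | efq _ ih => exact ih.map Der.ex_falso
  | raa _ ih => exact ih.impl_of_insert.map Der.of_neg_impl_fls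

/-- Soundness of the modal translation: if `Θ ⊢_ACR (p, Γ)` is
derivable in the Parsons–Jennings system, then the sequent `Γ ⊢_□ □_Θ p` is
derivable in the modal sequent calculus for the causal theory
`{(⋀Γ') ▷ q | (q, Γ') ∈ Θ}`. -/
theorem modal_translation_sound [DecidableEq α] (Θ : PJTheory α)
    (p : Fml α) (Γ : Finset (Fml α)) (h : ACR Θ p Γ) :
    Der (pjTheory Θ) (Fml.toM '' (↑Γ : Set (Fml α))) {MFml.box p.toM} :=
  (h.supported _).der_box
end

section
/- In any Parsons–Jennings derivation of Θ ⊢_ACR (p, Γ), the set of grounds Γ is a union of bodies of basic arguments of Θ; that is, Γ = ⋃_{j} Γ_j for some pairs (q_j, Γ_j) ∈ Θ. -/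
variable {α : Type}

/-- Every element of `Γ` lies in the body of some basic argument of `Θ` whose body is contained
in `Γ`. -/
def CoveredByBodies (Θ : PJTheory α) (Γ : Finset (Fml α)) : Prop :=
  ∀ s ∈ Γ, ∃ x ∈ Θ, s ∈ x.2 ∧ x.2 ⊆ Γ

namespace CoveredByBodies

theorem empty (Θ : PJTheory α) : CoveredByBodies Θ ∅ := by
  simp [CoveredByBodies]

theorem of_mem {Θ : PJTheory α} {p : Fml α} {Γ : Finset (Fml α)} (h : (p, Γ) ∈ Θ) :
    CoveredByBodies Θ Γ :=
  fun _ hs => ⟨(p, Γ), h, hs, subset_rfl⟩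

theorem union [DecidableEq α] {Θ : PJTheory α} {Γ Δ : Finset (Fml α)}
    (hΓ : CoveredByBodies Θ Γ) (hΔ : CoveredByBodies Θ Δ) : CoveredByBodies Θ (Γ ∪ Δ) := by
  intro s hs
  rcases Finset.mem_union.1 hs with hs | hs
  · obtain ⟨x, hx, hsx, hxΓ⟩ := hΓ s hs
    exact ⟨x, hx, hsx, hxΓ.trans Finset.subset_union_left⟩
  · obtain ⟨x, hx, hsx, hxΔ⟩ := hΔ s hs
    exact ⟨x, hx, hsx, hxΔ.trans Finset.subset_union_right⟩

theorem of_insert {Θ : PJTheory α} {p : Fml α} {Γ Δ : Finset (Fml α)}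
    (hΔ : CoveredByBodies Θ Δ) (hΓ : CoveredByBodies (insert (p, Δ) Θ) Γ) :
    CoveredByBodies Θ Γ := by
  intro s hs
  obtain ⟨x, rfl | hx, hsx, hxΓ⟩ := hΓ s hs
  · obtain ⟨y, hy, hsy, hyΔ⟩ := hΔ s hsx
    exact ⟨y, hy, hsy, hyΔ.trans hxΓ⟩
  · exact ⟨x, hx, hsx, hxΓ⟩

theorem exists_eq_biUnion {Θ : PJTheory α} {Γ : Finset (Fml α)} (h : CoveredByBodies Θ Γ) :
    ∃ A ⊆ Θ, (↑Γ : Set (Fml α)) = ⋃ x ∈ A, (↑x.2 : Set (Fml α)) := by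
  refine ⟨{x ∈ Θ | x.2 ⊆ Γ}, Set.sep_subset _ _, subset_antisymm ?_ ?_⟩
  · intro s hs
    obtain ⟨x, hx, hsx, hxΓ⟩ := h s hs
    exact Set.mem_biUnion (x := x) ⟨hx, hxΓ⟩ hsx
  · exact Set.iUnion₂_subset fun x hx => Finset.coe_subset.2 hx.2

end CoveredByBodies

theorem ACR.coveredByBodies [DecidableEq α] {Θ : PJTheory α} {p : Fml α} {Γ : Finset (Fml α)}
    (h : ACR Θ p Γ) : CoveredByBodies Θ Γ := by
  induction h with
  | ax h => exact .of_mem h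
  | truI => exact .empty _
  | conjI _ _ hp hq => exact hp.union hq
  | implE _ _ hp hpq => exact hp.union hpq
  | disjE _ _ _ hpq hp hq => exact (hpq.of_insert hp).union (hpq.of_insert hq)
  | negI _ h | implI _ h | raa _ h => exact (CoveredByBodies.empty _).of_insert h
  | negE _ _ h _ => exact h
  | conjE1 _ h | conjE2 _ h | disjI1 _ h | disjI2 _ h | efq _ h => exact h

/-- In any Parsons–Jennings derivation of `Θ ⊢_ACR (p, Γ)`, the
set of grounds `Γ` is a union of bodies of basic arguments of `Θ`; that is,
`Γ = ⋃_j Γ_j` for some pairs `(q_j, Γ_j) ∈ Θ`. -/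
theorem grounds_union_of_bodies [DecidableEq α] (Θ : PJTheory α)
    (p : Fml α) (Γ : Finset (Fml α)) (h : ACR Θ p Γ) :
    ∃ A ⊆ Θ, (↑Γ : Set (Fml α)) = ⋃ x ∈ A, (↑x.2 : Set (Fml α)) :=
  h.coveredByBodies.exists_eq_biUnion
end
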